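/- Let m ≥ 2 and k ≥ 2 be integers, let m' = ⌊log_2(m−1)⌋ and j = ⌈log_2(m − 2^{m'})⌉. If m ≤ P_{k−1}(Q_{k−1}), then for all sufficiently large n, sat(Q_n, GS_{k,m}) ≤ (k + 1 + m' + j/2^{m'}) · 2^(n−2). -/

import Mathlib

open SimpleGraph

/-- The hypercube graph `Q_n` on vertex set `{0,1}^n`: two vertices are adjacent
iff they differ in exactly one coordinate. -/
def hypercube (n : ℕ) : SimpleGraph (Fin n → Bool) :=
  SimpleGraph.fromRel (fun u v => hammingDist u v = 1)

/-- `HasCopy H G` means `H` contains a subgraph isomorphic to `G`. -/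
def HasCopy {V W : Type*} (H : SimpleGraph V) (G : SimpleGraph W) : Prop :=
  ∃ f : G →g H, Function.Injective f

/-- `IsSat Host H G`: `H` is an `(Host, G)`-saturated subgraph of `Host`. -/
def IsSat {V W : Type*} (Host H : SimpleGraph V) (G : SimpleGraph W) : Prop :=
  H ≤ Host ∧ ¬ HasCopy H G ∧
    ∀ u v : V, Host.Adj u v → ¬ H.Adj u v →
      HasCopy (H ⊔ SimpleGraph.fromEdgeSet {s(u, v)}) G

/-- The saturation number `sat(Host, G)`. -/
noncomputable def satNum {V W : Type*} (Host : SimpleGraph V) (G : SimpleGraph W) : ℕ :=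
  sInf { m | ∃ H : SimpleGraph V, IsSat Host H G ∧ H.edgeSet.ncard = m }

/-- The generalized star `GS_{k,m}`: a central vertex with `k` paths of length `m`
emanating from it, pairwise sharing only the center.  Leg `i`'s vertices are
`(i, 0), …, (i, m-1)`, with `(i, 0)` adjacent to the center. -/
def genStar (k m : ℕ) : SimpleGraph (Unit ⊕ Fin k × Fin m) :=
  SimpleGraph.fromRel (fun u v =>
    match u, v with
    | Sum.inl _, Sum.inr p => p.2.val = 0
    | Sum.inr p, Sum.inr q => p.1 = q.1 ∧ p.2.val + 1 = q.2.val
    | _, _ => False)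

/-- `hasFan k j ℓ`: `Q_k` contains `j` paths of length `ℓ` all starting at a common
vertex `v` and pairwise sharing no vertex other than `v`. -/
def hasFan (k j ℓ : ℕ) : Prop :=
  ∃ (v : Fin k → Bool) (e : Fin j → (Fin k → Bool))
    (p : ∀ i : Fin j, (hypercube k).Walk v (e i)),
      (∀ i, (p i).IsPath) ∧ (∀ i, (p i).length = ℓ) ∧
      ∀ i i', i ≠ i' → ∀ x, x ∈ (p i).support → x ∈ (p i').support → x = v

/-- `P_j(Q_k)`: the largest `ℓ` such that `Q_k` contains `j` vertex-disjoint
(except at the common start) paths of length `ℓ` from a common vertex. -/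
noncomputable def Pfan (j k : ℕ) : ℕ := sSup { ℓ | hasFan k j ℓ }

/-- Toggle the `i`-th bit of `x`. -/
def bitFlip {n : ℕ} (i : Fin n) (x : Fin n → Bool) : Fin n → Bool :=
  Function.update x i (!x i)

@[simp] lemma bitFlip_self {n : ℕ} (i : Fin n) (x : Fin n → Bool) : bitFlip i x i = !x i := by
  simp [bitFlip]

lemma bitFlip_of_ne {n : ℕ} {i j : Fin n} (h : j ≠ i) (x : Fin n → Bool) :
    bitFlip i x j = x j := by
  simp [bitFlip, h]

@[simp] lemma bitFlip_bitFlip {n : ℕ} (i : Fin n) (x : Fin n → Bool) :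
    bitFlip i (bitFlip i x) = x := by
  simp [bitFlip]

lemma bitFlip_left_injective {n : ℕ} (x : Fin n → Bool) :
    Function.Injective (fun i => bitFlip i x) := by
  intro i j h
  by_contra hij
  have := congrFun h i
  simp [bitFlip_of_ne hij] at this

lemma hypercube_adj_iff {n : ℕ} {x y : Fin n → Bool} :
    (hypercube n).Adj x y ↔ ∃ i, y = bitFlip i x := by
  have key : hammingDist x y = 1 ↔ ∃ i, y = bitFlip i x := by
    rw [hammingDist, Finset.card_eq_one]
    refine exists_congr fun i => ?_
    constructor
    · intro h
      have h' : ∀ j, x j ≠ y j ↔ j = i := fun j => by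
        have := Finset.ext_iff.1 h j
        simpa using this
      funext j
      by_cases hj : j = i
      · subst hj
        have := (h' j).2 rfl
        rw [bitFlip_self]
        revert this
        cases x j <;> cases y j <;> simp
      · rw [bitFlip_of_ne hj]
        by_contra hne
        exact hj ((h' j).1 (Ne.symm hne))
    · rintro rfl
      ext j
      by_cases hj : j = i
      · subst hj
        simp
      · simp [bitFlip_of_ne hj, hj]
  rw [hypercube, SimpleGraph.fromRel_adj, hammingDist_comm y x, or_self, key]
  refine ⟨fun h => h.2, fun h => ⟨?_, h⟩⟩
  rintro rfl
  obtain ⟨i, hi⟩ := h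
  have := congrFun hi i
  simp at this

/-- The parity of the first `K` bits of `x`. -/
def prefixParity {n : ℕ} (K : ℕ) (x : Fin n → Bool) : ZMod 2 :=
  ∑ i : Fin n, if i.val < K ∧ x i = true then 1 else 0

lemma prefixParity_bitFlip_of_lt {n K : ℕ} {i : Fin n} (hi : i.val < K) (x : Fin n → Bool) :
    prefixParity K (bitFlip i x) = prefixParity K x + 1 := by
  have h : ∀ j : Fin n, (if j.val < K ∧ bitFlip i x j = true then (1 : ZMod 2) else 0) =
      (if j.val < K ∧ x j = true then 1 else 0) + if j = i then 1 else 0 := by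
    intro j
    by_cases hj : j = i
    · subst hj
      cases hx : x j <;> simp [hi, hx]
      decide
    · simp [hj, bitFlip_of_ne hj]
  simp only [prefixParity, h, Finset.sum_add_distrib, Finset.sum_ite_eq', Finset.mem_univ, if_true]

lemma prefixParity_bitFlip_of_le {n K : ℕ} {i : Fin n} (hi : K ≤ i.val) (x : Fin n → Bool) :
    prefixParity K (bitFlip i x) = prefixParity K x := by
  refine Finset.sum_congr rfl fun j _ => ?_
  by_cases hj : j = i
  · subst hj
    simp [hi.not_gt]
  · simp [bitFlip_of_ne hj]

/-- The direction of the matching edge at `x`: bit `K` or bit `K + 1`, according to the parity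
of the first `K` bits. -/
def matchDir {n K : ℕ} (hn : K + 2 ≤ n) (x : Fin n → Bool) : Fin n :=
  if prefixParity K x = 0 then ⟨K, by omega⟩ else ⟨K + 1, by omega⟩

/-- The vertices whose bits `K` and `K + 1` agree. -/
def InCore {n K : ℕ} (hn : K + 2 ≤ n) (x : Fin n → Bool) : Prop :=
  x ⟨K, by omega⟩ = x ⟨K + 1, by omega⟩

lemma le_matchDir {n K : ℕ} (hn : K + 2 ≤ n) (x : Fin n → Bool) : K ≤ (matchDir hn x).val := by
  unfold matchDir
  split_ifs <;> simp

lemma matchDir_lt {n K : ℕ} (hn : K + 2 ≤ n) (x : Fin n → Bool) :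
    (matchDir hn x).val < K + 2 := by
  unfold matchDir
  split_ifs <;> simp

lemma matchDir_bitFlip_of_le {n K : ℕ} (hn : K + 2 ≤ n) {i : Fin n} (hi : K ≤ i.val)
    (x : Fin n → Bool) : matchDir hn (bitFlip i x) = matchDir hn x := by
  simp only [matchDir, prefixParity_bitFlip_of_le hi]

lemma matchDir_bitFlip_ne_of_lt {n K : ℕ} (hn : K + 2 ≤ n) {i : Fin n} (hi : i.val < K)
    (x : Fin n → Bool) : matchDir hn (bitFlip i x) ≠ matchDir hn x := by
  simp only [matchDir, prefixParity_bitFlip_of_lt hi]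
  have h2 : ∀ a : ZMod 2, a = 0 ∨ a ≠ 0 ∧ a + 1 = 0 := by decide
  rcases h2 (prefixParity K x) with h | ⟨h, h'⟩
  · simp [h]
  · simp [h, h']

lemma inCore_bitFlip_of_mem {n K : ℕ} (hn : K + 2 ≤ n) {i : Fin n} (h1 : K ≤ i.val)
    (h2 : i.val < K + 2) (x : Fin n → Bool) : InCore hn (bitFlip i x) ↔ ¬ InCore hn x := by
  have hb : ∀ a b : Bool, ((!a) = b ↔ ¬ a = b) ∧ (a = (!b) ↔ ¬ a = b) := by decide
  unfold InCore
  obtain h | h : i = ⟨K, by omega⟩ ∨ i = ⟨K + 1, by omega⟩ := by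
    simp only [Fin.ext_iff]; omega
  · rw [h, bitFlip_self, bitFlip_of_ne (by simp)]
    exact (hb _ _).1
  · rw [h, bitFlip_self, bitFlip_of_ne (by simp)]
    exact (hb _ _).2

lemma inCore_bitFlip_of_notMem {n K : ℕ} (hn : K + 2 ≤ n) {i : Fin n}
    (h : ¬ (K ≤ i.val ∧ i.val < K + 2)) (x : Fin n → Bool) :
    InCore hn (bitFlip i x) ↔ InCore hn x := by
  unfold InCore
  rw [bitFlip_of_ne (by rintro rfl; simp at h), bitFlip_of_ne (by rintro rfl; simp at h)]

lemma inCore_bitFlip_matchDir {n K : ℕ} (hn : K + 2 ≤ n) (x : Fin n → Bool) :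
    InCore hn (bitFlip (matchDir hn x) x) ↔ ¬ InCore hn x :=
  inCore_bitFlip_of_mem hn (le_matchDir hn x) (matchDir_lt hn x) x

/-- Disjoint copies of `Q_K` spanned by the first `K` directions on the core vertices, with one
pendant vertex outside the core attached to every core vertex. -/
def pendantCubes (n K : ℕ) (hn : K + 2 ≤ n) : SimpleGraph (Fin n → Bool) where
  Adj x y := ∃ i, y = bitFlip i x ∧ (i = matchDir hn x ∨ (i.val < K ∧ InCore hn x))
  symm := ⟨by
    rintro x y ⟨i, rfl, h⟩
    refine ⟨i, by simp, ?_⟩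
    rcases h with rfl | ⟨hi, hx⟩
    · exact Or.inl (matchDir_bitFlip_of_le hn (le_matchDir hn x) x).symm
    · exact Or.inr ⟨hi, (inCore_bitFlip_of_notMem hn (by omega) x).2 hx⟩⟩
  loopless := ⟨by
    rintro x ⟨i, h, -⟩
    have := congrFun h i
    simp at this⟩

lemma pendantCubes_adj_matchDir {n K : ℕ} (hn : K + 2 ≤ n) (x : Fin n → Bool) :
    (pendantCubes n K hn).Adj x (bitFlip (matchDir hn x) x) :=
  ⟨_, rfl, Or.inl rfl⟩

lemma pendantCubes_le_hypercube {n K : ℕ} (hn : K + 2 ≤ n) :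
    pendantCubes n K hn ≤ hypercube n := by
  rintro x y ⟨i, h, -⟩
  exact hypercube_adj_iff.2 ⟨i, h⟩

lemma not_hasCopy_pendantCubes {n K m : ℕ} (hn : K + 2 ≤ n) (hK : 1 ≤ K) (hm : 2 ≤ m) :
    ¬ HasCopy (pendantCubes n K hn) (genStar (K + 1) m) := by
  rintro ⟨f, hf⟩
  set c := f (Sum.inl ()) with hc
  have hadj : ∀ i : Fin (K + 1), (pendantCubes n K hn).Adj c (f (Sum.inr (i, ⟨0, by omega⟩))) :=
    fun i => f.map_adj (by simp [genStar])
  choose a ha hcase using hadj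
  have ha_inj : Function.Injective a := by
    intro i i' h
    have h' : f (Sum.inr (i, ⟨0, by omega⟩)) = f (Sum.inr (i', ⟨0, by omega⟩)) := by
      rw [ha, ha, h]
    simpa using hf h'
  by_cases hcore : InCore hn c
  · obtain ⟨i, hi⟩ : ∃ i, a i = matchDir hn c := by
      by_contra! hno
      have hlt : ∀ i, (a i).val < K := fun i => ((hcase i).resolve_left (hno i)).1
      have := Fintype.card_le_of_injective (fun i => (⟨(a i).val, hlt i⟩ : Fin K)) (by
        intro i i' h
        exact ha_inj (Fin.ext (by simpa using h)))
      simp at this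
    have hadj2 : (pendantCubes n K hn).Adj (f (Sum.inr (i, ⟨0, by omega⟩)))
        (f (Sum.inr (i, ⟨1, by omega⟩))) := f.map_adj (by simp [genStar])
    rw [ha, hi] at hadj2
    obtain ⟨b, hb, hb'⟩ := hadj2
    rw [inCore_bitFlip_matchDir, matchDir_bitFlip_of_le hn (le_matchDir hn c)] at hb'
    have hbd : b = matchDir hn c := hb'.resolve_right fun h => h.2 hcore
    rw [hbd, bitFlip_bitFlip] at hb
    have := hf hb
    simp at this
  · have h0 := (hcase ⟨0, by omega⟩).resolve_right fun h => hcore h.2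
    have h1 := (hcase ⟨1, by omega⟩).resolve_right fun h => hcore h.2
    have := ha_inj (h0.trans h1.symm)
    simp at this

open Classical in
lemma degree_pendantCubes_le {n K : ℕ} (hn : K + 2 ≤ n) (x : Fin n → Bool) :
    (pendantCubes n K hn).degree x ≤ 1 + if InCore hn x then K else 0 := by
  have hsub : (pendantCubes n K hn).neighborFinset x ⊆
      (insert (matchDir hn x) (Finset.univ.filter fun i : Fin n => i.val < K ∧ InCore hn x)).image
        (fun i => bitFlip i x) := by
    intro y hy
    rw [SimpleGraph.mem_neighborFinset] at hy
    obtain ⟨i, rfl, h⟩ := hy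
    exact Finset.mem_image_of_mem _ (by simpa using h)
  have hfilter : (Finset.univ.filter fun i : Fin n => i.val < K ∧ InCore hn x).card ≤
      if InCore hn x then K else 0 := by
    split_ifs with h
    · refine (Finset.card_le_card_of_injOn (t := Finset.range K) Fin.val ?_
        Fin.val_injective.injOn).trans (Finset.card_range K).le
      intro i hi
      simpa [h] using hi
    · simp [h]
  have h1 := (Finset.card_le_card hsub).trans Finset.card_image_le
  have h2 := h1.trans (Finset.card_insert_le _ _)
  rw [SimpleGraph.card_neighborFinset_eq_degree] at h2
  omega

lemma ncard_edgeSet_pendantCubes_le {n K : ℕ} (hn : K + 2 ≤ n) :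
    (pendantCubes n K hn).edgeSet.ncard ≤ (K + 2) * 2 ^ (n - 2) := by
  classical
  set d : Fin n := ⟨K, by omega⟩
  have hpair : ∀ x, (pendantCubes n K hn).degree x +
      (pendantCubes n K hn).degree (bitFlip d x) ≤ K + 2 := by
    intro x
    have h1 := degree_pendantCubes_le hn x
    have h2 := degree_pendantCubes_le hn (bitFlip d x)
    rw [inCore_bitFlip_of_mem hn (by simp [d]) (by simp [d])] at h2
    by_cases h : InCore hn x <;> simp [h] at h1 h2 <;> omega
  have hinv : Function.Involutive (bitFlip d) := fun x => bitFlip_bitFlip d x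
  have hperm : ∑ x, (pendantCubes n K hn).degree (bitFlip d x) =
      ∑ x, (pendantCubes n K hn).degree x :=
    Equiv.sum_comp hinv.toPerm (fun x => (pendantCubes n K hn).degree x)
  have hsum : ∑ x, ((pendantCubes n K hn).degree x +
      (pendantCubes n K hn).degree (bitFlip d x)) ≤ 2 ^ n * (K + 2) := by
    refine (Finset.sum_le_card_nsmul _ _ _ fun x _ => hpair x).trans ?_
    simp
  rw [Finset.sum_add_distrib, hperm, SimpleGraph.sum_degrees_eq_twice_card_edges] at hsum
  rw [← SimpleGraph.coe_edgeFinset, Set.ncard_coe_finset]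
  obtain ⟨r, rfl⟩ : ∃ r, n = r + 2 := ⟨n - 2, by omega⟩
  rw [Nat.add_sub_cancel]
  rw [pow_add] at hsum
  nlinarith

/-- The copy of `Q_K` in the first `K` directions through `x`, placed so that `v` goes to `x`. -/
def cubeAt {n K : ℕ} (v : Fin K → Bool) (x : Fin n → Bool) (z : Fin K → Bool) : Fin n → Bool :=
  fun i => if h : i.val < K then xor (z ⟨i, h⟩) (xor (v ⟨i, h⟩) (x i)) else x i

lemma cubeAt_base {n K : ℕ} (v : Fin K → Bool) (x : Fin n → Bool) : cubeAt v x v = x := by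
  funext i
  unfold cubeAt
  split_ifs <;> simp

lemma cubeAt_apply_of_le {n K : ℕ} (v : Fin K → Bool) (x : Fin n → Bool) (z : Fin K → Bool)
    {i : Fin n} (hi : K ≤ i.val) : cubeAt v x z i = x i := by
  simp [cubeAt, hi.not_gt]

lemma cubeAt_injective {n K : ℕ} (hn : K ≤ n) (v : Fin K → Bool) (x : Fin n → Bool) :
    Function.Injective (cubeAt v x) := by
  intro z z' h
  funext i
  have := congrFun h ⟨i.val, by omega⟩
  simpa [cubeAt] using this

lemma cubeAt_bitFlip {n K : ℕ} (hn : K ≤ n) (v : Fin K → Bool) (x : Fin n → Bool)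
    (z : Fin K → Bool) (i : Fin K) :
    cubeAt v x (bitFlip i z) = bitFlip ⟨i.val, by omega⟩ (cubeAt v x z) := by
  funext j
  by_cases hj : j = ⟨i.val, by omega⟩
  · subst hj
    simp [cubeAt]
  · rw [bitFlip_of_ne hj]
    unfold cubeAt
    split_ifs with h
    · rw [bitFlip_of_ne (by simpa [Fin.ext_iff] using hj)]
    · rfl

lemma inCore_cubeAt {n K : ℕ} (hn : K + 2 ≤ n) (v : Fin K → Bool) (x : Fin n → Bool)
    (z : Fin K → Bool) : InCore hn (cubeAt v x z) ↔ InCore hn x := by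
  unfold InCore
  rw [cubeAt_apply_of_le v x z (by simp), cubeAt_apply_of_le v x z (by simp)]

/-- `cubeAt` as a homomorphism into `pendantCubes`. -/
def cubeHom {n K : ℕ} (hn : K + 2 ≤ n) (v : Fin K → Bool) {x : Fin n → Bool}
    (hx : InCore hn x) : hypercube K →g pendantCubes n K hn where
  toFun := cubeAt v x
  map_rel' := by
    intro z z' h
    obtain ⟨i, rfl⟩ := hypercube_adj_iff.1 h
    exact ⟨_, cubeAt_bitFlip (by omega) v x z i, Or.inr ⟨i.isLt, (inCore_cubeAt hn v x z).2 hx⟩⟩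

/-- Legs given as vertex sequences, starting at `c` and otherwise disjoint, form a generalized
star. -/
lemma hasCopy_genStar_of_legs {V : Type*} {G : SimpleGraph V} {k m : ℕ} (c : V)
    (L : Fin k → ℕ → V) (h0 : ∀ i, L i 0 = c)
    (hadj : ∀ i, ∀ t < m, G.Adj (L i t) (L i (t + 1)))
    (hinj : ∀ i i' t t', t ≤ m → t' ≤ m → 0 < t → L i t = L i' t' → i = i' ∧ t = t') :
    HasCopy G (genStar k m) := by
  let f : Unit ⊕ Fin k × Fin m → V := Sum.elim (fun _ => c) fun p => L p.1 (p.2.val + 1)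
  have key : ∀ u w, (match u, w with
      | Sum.inl _, Sum.inr p => p.2.val = 0
      | Sum.inr p, Sum.inr q => p.1 = q.1 ∧ p.2.val + 1 = q.2.val
      | _, _ => False : Prop) → G.Adj (f u) (f w) := by
    rintro (u | ⟨i, s⟩) (w | ⟨i', t⟩) h
    · exact h.elim
    · have ht : t.val = 0 := h
      have := hadj i' 0 (by omega)
      rw [h0] at this
      simpa [f, ht] using this
    · exact h.elim
    · obtain ⟨rfl, h2⟩ : i = i' ∧ s.val + 1 = t.val := h
      have := hadj i (s.val + 1) (by omega)
      simpa [f, ← h2] using this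
  refine ⟨⟨f, ?_⟩, ?_⟩
  · intro u w h
    rw [genStar, SimpleGraph.fromRel_adj] at h
    rcases h.2 with h | h
    · exact key u w h
    · exact (key w u h).symm
  · rintro (u | ⟨i, s⟩) (w | ⟨i', t⟩) h
    · rfl
    · have h' : L i' (t.val + 1) = L i' 0 := by rw [h0]; exact h.symm
      have := (hinj i' i' _ _ (by omega) (by omega) (by omega) h').2
      omega
    · have h' : L i (s.val + 1) = L i 0 := by rw [h0]; exact h
      have := (hinj i i _ _ (by omega) (by omega) (by omega) h').2
      omega
    · have h' : L i (s.val + 1) = L i' (t.val + 1) := h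
      obtain ⟨rfl, h2⟩ := hinj i i' _ _ (by omega) (by omega) (by omega) h'
      have : s = t := Fin.ext (by omega)
      rw [this]

/-- A fan of `K` paths in `Q_K` through a core vertex `x`, together with one more path from `x`
leaving its cube, contains a generalized star with `K + 1` legs. -/
lemma hasCopy_of_fan_of_path {n K m : ℕ} (hn : K + 2 ≤ n) {v : Fin K → Bool}
    {e : Fin K → (Fin K → Bool)} (p : ∀ i, (hypercube K).Walk v (e i))
    (hp : ∀ i, (p i).IsPath) (hlen : ∀ i, m ≤ (p i).length)
    (hdisj : ∀ i i', i ≠ i' → ∀ x, x ∈ (p i).support → x ∈ (p i').support → x = v)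
    {G : SimpleGraph (Fin n → Bool)} (hG : pendantCubes n K hn ≤ G)
    {x y : Fin n → Bool} (hx : InCore hn x) (q : G.Walk x y) (hq : q.IsPath)
    (hqlen : m ≤ q.length)
    (hqout : ∀ z ∈ q.support, z ≠ x → ∃ i : Fin n, K ≤ i.val ∧ z i ≠ x i) :
    HasCopy G (genStar (K + 1) m) := by
  let leg : Fin K → ℕ → (Fin n → Bool) := fun i t => cubeAt v x ((p i).getVert t)
  have hleg : ∀ (i : Fin K) (s t : ℕ), t ≤ m → 0 < t → leg i s ≠ q.getVert t := by
    intro i s t ht h0 h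
    have hne : q.getVert t ≠ x := by
      intro h'
      have := hq.getVert_injOn (by simp; omega) (by simp)
        (h'.trans q.getVert_zero.symm)
      omega
    obtain ⟨d, hd, hd'⟩ := hqout _ (q.getVert_mem_support t) hne
    rw [← h] at hd'
    exact hd' (cubeAt_apply_of_le v x _ hd)
  have hfan : ∀ i i' t t', t ≤ m → t' ≤ m → 0 < t → leg i t = leg i' t' → i = i' ∧ t = t' := by
    intro i i' t t' ht ht' h0 h
    have h' := cubeAt_injective (by omega) v x h
    have hl := hlen i
    have hl' := hlen i'
    by_cases hii : i = i'
    · subst hii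
      exact ⟨rfl, (hp i).getVert_injOn (by simp; omega) (by simp; omega) h'⟩
    · have hv := hdisj i i' hii _ ((p i).getVert_mem_support t)
        (h' ▸ (p i').getVert_mem_support t')
      have := (hp i).getVert_injOn (by simp; omega) (by simp)
        (hv.trans (p i).getVert_zero.symm)
      omega
  refine hasCopy_genStar_of_legs x (Fin.snoc (α := fun _ => ℕ → (Fin n → Bool)) leg q.getVert)
    ?_ ?_ ?_
  · intro i
    refine Fin.lastCases ?_ (fun i => ?_) i
    · simp
    · simp [leg, cubeAt_base]
  · intro i t ht
    refine Fin.lastCases ?_ (fun i => ?_) i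
    · simpa using q.adj_getVert_succ (by omega)
    · have hl := hlen i
      have := hG ((cubeHom hn v hx).map_adj ((p i).adj_getVert_succ (i := t) (by omega)))
      simpa [leg, cubeHom] using this
  · intro i i' t t' ht ht' h0
    refine Fin.lastCases ?_ (fun i => ?_) i <;> refine Fin.lastCases ?_ (fun i' => ?_) i'
    · intro h
      simp only [Fin.snoc_last] at h
      exact ⟨rfl, hq.getVert_injOn (by simp; omega) (by simp; omega) h⟩
    · intro h
      simp only [Fin.snoc_last, Fin.snoc_castSucc] at h
      exact (hleg i' t' t ht h0 h.symm).elim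
    · intro h
      simp only [Fin.snoc_last, Fin.snoc_castSucc] at h
      rcases Nat.eq_zero_or_pos t' with rfl | h0'
      · have hK : leg i t = leg i 0 := by
          rw [h]; simp [leg, cubeAt_base]
        have := (hfan i i t 0 ht (by omega) h0 hK).2
        omega
      · exact (hleg i t t' ht' h0' h).elim
    · intro h
      simp only [Fin.snoc_castSucc] at h
      obtain ⟨rfl, h2⟩ := hfan i i' t t' ht ht' h0 h
      exact ⟨rfl, h2⟩

/-- From every core vertex there starts a path as long as the fan paths inside its cube. -/
lemma exists_path_in_cube {n K m : ℕ} (hn : K + 2 ≤ n) {v e : Fin K → Bool}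
    (p : (hypercube K).Walk v e) (hp : p.IsPath) (hlen : m ≤ p.length)
    {G : SimpleGraph (Fin n → Bool)} (hG : pendantCubes n K hn ≤ G)
    {x : Fin n → Bool} (hx : InCore hn x) :
    ∃ (y : Fin n → Bool) (q : G.Walk x y), q.IsPath ∧ m ≤ q.length ∧
      ∀ z ∈ q.support, ∀ i : Fin n, K ≤ i.val → z i = x i := by
  let f : hypercube K →g G := (SimpleGraph.Hom.ofLE hG).comp (cubeHom hn v hx)
  have hf : Function.Injective f := cubeAt_injective (by omega) v x
  have hfv : f v = x := cubeAt_base v x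
  refine ⟨f e, (p.map f).copy hfv rfl, ?_, by simpa using hlen, ?_⟩
  · simpa using hp.map hf
  · intro z hz i hi
    simp only [SimpleGraph.Walk.support_copy, SimpleGraph.Walk.support_map, List.mem_map] at hz
    obtain ⟨a, -, rfl⟩ := hz
    exact cubeAt_apply_of_le v x a hi

lemma hasCopy_pendantCubes_sup_edge {n K m : ℕ} (hn : K + 2 ≤ n) {v : Fin K → Bool}
    {e : Fin K → (Fin K → Bool)} (p : ∀ i, (hypercube K).Walk v (e i))
    (hp : ∀ i, (p i).IsPath) (hlen : ∀ i, m ≤ (p i).length)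
    (hdisj : ∀ i i', i ≠ i' → ∀ x, x ∈ (p i).support → x ∈ (p i').support → x = v)
    (hK : 0 < K) {x y : Fin n → Bool} (hxy : (hypercube n).Adj x y)
    (hH : ¬ (pendantCubes n K hn).Adj x y) :
    HasCopy (pendantCubes n K hn ⊔ SimpleGraph.fromEdgeSet {s(x, y)}) (genStar (K + 1) m) := by
  wlog hwlog : InCore hn x ∨ ¬ InCore hn y generalizing x y
  · rw [Sym2.eq_swap]
    exact this hxy.symm (fun h => hH h.symm) (by tauto)
  set G := pendantCubes n K hn ⊔ SimpleGraph.fromEdgeSet {s(x, y)} with hGdef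
  have hG : pendantCubes n K hn ≤ G := le_sup_left
  have hGxy : G.Adj x y := Or.inr (by simpa using hxy.ne)
  have hpath := fun {u : Fin n → Bool} (hu : InCore hn u) =>
    exists_path_in_cube hn (p ⟨0, hK⟩) (hp _) (hlen _) hG hu
  obtain ⟨i, rfl⟩ := hypercube_adj_iff.1 hxy
  set y := bitFlip i x with hy
  have hdx : i ≠ matchDir hn x := fun h => hH ⟨i, rfl, Or.inl h⟩
  have hyx : ∀ j, j ≠ i → y j = x j := fun j hj => bitFlip_of_ne hj x
  have hyi : y i ≠ x i := by simp [hy]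
  by_cases hy' : InCore hn y
  · have hx : InCore hn x := by tauto
    have hiK : K ≤ i.val := by
      by_contra h
      exact hH ⟨i, rfl, Or.inr ⟨by omega, hx⟩⟩
    obtain ⟨b, q, hq, hql, hqs⟩ := hpath hy'
    have hout : ∀ z ∈ q.support, z i ≠ x i := fun z hz => by rwa [hqs z hz i hiK]
    refine hasCopy_of_fan_of_path hn p hp hlen hdisj hG hx (q.cons hGxy) ?_
      (by simp; omega) ?_
    · exact (SimpleGraph.Walk.cons_isPath_iff _ _).2 ⟨hq, fun h => hout x h rfl⟩
    · intro z hz hzx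
      simp only [SimpleGraph.Walk.support_cons, List.mem_cons] at hz
      exact ⟨i, hiK, hout z (hz.resolve_left hzx)⟩
  set d := matchDir hn y with hd
  set u := bitFlip d y with hu
  have hdK : K ≤ d.val := le_matchDir hn y
  have huc : InCore hn u := (inCore_bitFlip_matchDir hn y).2 hy'
  have hyu : G.Adj y u := hG (pendantCubes_adj_matchDir hn y)
  have hud : u d ≠ y d := by simp [hu]
  have huy : ∀ j, j ≠ d → u j = y j := fun j hj => bitFlip_of_ne hj y
  obtain ⟨b, q, hq, hql, hqs⟩ := hpath huc
  have hyq : y ∉ q.support := fun h => hud (hqs y h d hdK).symm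
  have hq1 : (q.cons hyu).IsPath := (SimpleGraph.Walk.cons_isPath_iff _ _).2 ⟨hq, hyq⟩
  have hid : i ≠ d := by
    rcases Nat.lt_or_ge i.val K with h | h
    · intro h'
      rw [h'] at h
      omega
    · rwa [hd, hy, matchDir_bitFlip_of_le hn h]
  have hxq : x ∉ q.support := fun h => hud (by
    rw [← hqs x h d hdK, hyx d (Ne.symm hid)])
  have hq2 : ((q.cons hyu).cons hGxy).IsPath :=
    (SimpleGraph.Walk.cons_isPath_iff _ _).2 ⟨hq1, by
      simpa [SimpleGraph.Walk.support_cons] using ⟨hxy.ne, hxq⟩⟩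
  by_cases hx : InCore hn x
  · have hiK : K ≤ i.val := by
      by_contra h
      exact hH ⟨i, rfl, Or.inr ⟨by omega, hx⟩⟩
    refine hasCopy_of_fan_of_path hn p hp hlen hdisj hG hx _ hq2 (by simp; omega) ?_
    intro z hz hzx
    simp only [SimpleGraph.Walk.support_cons, List.mem_cons] at hz
    refine ⟨i, hiK, ?_⟩
    rcases hz.resolve_left hzx with rfl | hz
    · exact hyi
    · rwa [hqs z hz i hiK, huy i hid]
  · set d' := matchDir hn x with hd'
    set w := bitFlip d' x with hw
    have hdK' : K ≤ d'.val := le_matchDir hn x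
    have hwc : InCore hn w := (inCore_bitFlip_matchDir hn x).2 hx
    have hwx : G.Adj w x := (hG (pendantCubes_adj_matchDir hn x)).symm
    have hwd : w d' ≠ x d' := by simp [hw]
    have hww : ∀ j, j ≠ d' → w j = x j := fun j hj => bitFlip_of_ne hj x
    have hout : ∀ z, z = x ∨ z = y ∨ z ∈ q.support → ∃ j : Fin n, K ≤ j.val ∧ z j ≠ w j := by
      rintro z (rfl | rfl | hz)
      · exact ⟨d', hdK', hwd.symm⟩
      · exact ⟨d', hdK', by rw [hyx d' (Ne.symm hdx)]; exact hwd.symm⟩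
      · rcases Nat.lt_or_ge i.val K with h | h
        · have hdd : d' ≠ d := (matchDir_bitFlip_ne_of_lt hn h x).symm
          exact ⟨d', hdK', by
            rw [hqs z hz d' hdK', huy d' hdd, hyx d' (Ne.symm hdx)]; exact hwd.symm⟩
        · exact ⟨i, h, by rw [hqs z hz i h, huy i hid, hww i hdx]; exact hyi⟩
    have hq3 : (((q.cons hyu).cons hGxy).cons hwx).IsPath := by
      refine (SimpleGraph.Walk.cons_isPath_iff _ _).2 ⟨hq2, fun h => ?_⟩
      simp only [SimpleGraph.Walk.support_cons, List.mem_cons] at h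
      obtain ⟨j, -, hj⟩ := hout w h
      exact hj rfl
    refine hasCopy_of_fan_of_path hn p hp hlen hdisj hG hwc _ hq3 (by simp; omega) ?_
    intro z hz hzw
    simp only [SimpleGraph.Walk.support_cons, List.mem_cons] at hz
    exact hout z (hz.resolve_left hzw)

lemma exists_hasFan_of_le_Pfan {k j m : ℕ} (hm : 0 < m) (h : m ≤ Pfan j k) :
    ∃ ℓ, m ≤ ℓ ∧ hasFan k j ℓ := by
  refine ⟨Pfan j k, h, ?_⟩
  refine Nat.sSup_mem (s := { ℓ | hasFan k j ℓ }) ?_ ?_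
  · by_contra hne
    rw [Set.not_nonempty_iff_eq_empty] at hne
    simp [Pfan, hne] at h
    omega
  · by_contra hb
    have := Nat.sSup_of_not_bddAbove hb
    rw [Pfan, this] at h
    omega

/-- upper bound on `sat(Q_n, GS_{k,m})` where `m' = ⌊log₂(m-1)⌋`
and `j = ⌈log₂(m - 2^{m'})⌉`, assuming `m ≤ P_{k-1}(Q_{k-1})`. -/
theorem stmt3 (m k : ℕ) (hm : 2 ≤ m) (hk : 2 ≤ k)
    (m' j : ℕ) (hm' : m' = Nat.log 2 (m - 1)) (hj : j = Nat.clog 2 (m - 2 ^ m'))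
    (hfan : m ≤ Pfan (k - 1) (k - 1)) :
    ∃ N : ℕ, ∀ n ≥ N,
      (satNum (hypercube n) (genStar k m) : ℝ) ≤
        ((k : ℝ) + 1 + m' + (j : ℝ) / 2 ^ m') * 2 ^ (n - 2) := by
  obtain ⟨K, rfl⟩ : ∃ K, k = K + 1 := ⟨k - 1, by omega⟩
  simp only [Nat.add_sub_cancel] at hfan
  obtain ⟨ℓ, hℓ, v, e, p, hp, hlen, hdisj⟩ := exists_hasFan_of_le_Pfan (by omega) hfan
  refine ⟨K + 2, fun n hn => ?_⟩
  have hsat : IsSat (hypercube n) (pendantCubes n K hn) (genStar (K + 1) m) := by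
    refine ⟨pendantCubes_le_hypercube hn, not_hasCopy_pendantCubes hn (by omega) hm,
      fun x y hxy hH => ?_⟩
    exact hasCopy_pendantCubes_sup_edge hn p hp (fun i => (hlen i).symm ▸ hℓ) hdisj
      (by omega) hxy hH
  have hle : satNum (hypercube n) (genStar (K + 1) m) ≤ (pendantCubes n K hn).edgeSet.ncard :=
    Nat.sInf_le ⟨_, hsat, rfl⟩
  have hcard := hle.trans (ncard_edgeSet_pendantCubes_le hn)
  have hcard' : (satNum (hypercube n) (genStar (K + 1) m) : ℝ) ≤ ((K : ℝ) + 2) * 2 ^ (n - 2) := by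
    exact_mod_cast hcard
  refine hcard'.trans ?_
  refine mul_le_mul_of_nonneg_right ?_ (by positivity)
  have h1 : (0 : ℝ) ≤ m' := by positivity
  have h2 : (0 : ℝ) ≤ (j : ℝ) / 2 ^ m' := by positivity
  push_cast
  linarith
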